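/- Let n ≥ 1 and let α be an MVP parking function with O_n(α) = w_0. Then the step sequence s(α) is a Motzkin step sequence of length n: every partial sum s_1(α) + ⋯ + s_i(α) (1 ≤ i ≤ n) is nonnegative, and the total sum s_1(α) + ⋯ + s_n(α) equals 0. -/

import Mathlib

open Finset

namespace MVPPark

/-- One step of the MVP parking process: car `c`, preferring spot `p`, arrives at the
state `state` (recording, for each spot, the car parked there, if any).  Car `c` always
parks in spot `p`; if spot `p` was occupied by an (earlier) car `j`, then `j` is bumped
and parks in the first unoccupied spot strictly beyond `p`, if such a spot exists
(otherwise `j` drives off unparked). -/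
def mvpStep {n : ℕ} (state : Fin n → Option (Fin n)) (c p : Fin n) :
    Fin n → Option (Fin n) :=
  match state p with
  | none => Function.update state p (some c)
  | some j =>
    match (List.finRange n).find? (fun k => decide (p < k) && (state k).isNone) with
    | none => Function.update state p (some c)
    | some k => Function.update (Function.update state p (some c)) k (some j)

/-- The final state of the MVP parking process with preference list `α`:
cars `0, 1, …, n-1` enter in order, car `i` preferring spot `α i`. -/
def mvpRun {n : ℕ} (α : Fin n → Fin n) : Fin n → Option (Fin n) :=
  (List.finRange n).foldl (fun st c => mvpStep st c (α c)) (fun _ => none)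

/-- `α` is an MVP parking function: under the MVP rule, all `n` cars end up parked. -/
def IsMVP {n : ℕ} (α : Fin n → Fin n) : Prop :=
  ∀ c : Fin n, ∃ j : Fin n, mvpRun α j = some c

/-- The outcome of the MVP parking process on `α` is the permutation `π`:
for each `j`, spot `j` ends up occupied by car `π j`. -/
def MvpOutcome {n : ℕ} (α : Fin n → Fin n) (π : Equiv.Perm (Fin n)) : Prop :=
  ∀ j : Fin n, mvpRun α j = some (π j)

end MVPPark

namespace MVPPark

/-- `m_j(α)`: the number of cars preferring spot `j` under the preference list `α`. -/
def mcount {n : ℕ} (α : Fin n → Fin n) (j : Fin n) : ℕ :=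
  (Finset.univ.filter (fun i => α i = j)).card

end MVPPark

namespace MVPPark

/-- The step sequence of `α`: `1` at spots preferred by at least two cars, `0` at spots
preferred by exactly one car, and `-1` at spots preferred by no car. -/
def stepSeq {n : ℕ} (α : Fin n → Fin n) (j : Fin n) : ℤ :=
  if 2 ≤ mcount α j then 1 else if mcount α j = 1 then 0 else -1

end MVPPark

namespace MVPPark

variable {n : ℕ}

lemma mvpStep_eq (s : Fin n → Option (Fin n)) (c p : Fin n) :
    mvpStep s c p = Function.update s p (some c) ∨
      ∃ j k, s p = some j ∧ (p < k ∧ s k = none ∧ ∀ r, p < r → r < k → s r ≠ none) ∧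
        mvpStep s c p = Function.update (Function.update s p (some c)) k (some j) := by
  unfold mvpStep
  rcases hp : s p with _ | j
  · exact .inl rfl
  rcases hk : (List.finRange n).find? (fun k => decide (p < k) && (s k).isNone) with _ | k
  · exact .inl rfl
  refine .inr ⟨j, k, rfl, ?_, rfl⟩
  rw [List.find?_eq_some_iff_getElem] at hk
  obtain ⟨hk, i, hi, hik, hlt⟩ := hk
  simp only [List.getElem_finRange] at hik hlt
  simp only [Bool.and_eq_true, decide_eq_true_eq, Option.isNone_iff_eq_none] at hk
  refine ⟨hk.1, hk.2, fun r hpr hrk hr => ?_⟩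
  have := hlt r.1 (by have := congrArg Fin.val hik; simp at this; omega)
  simp [hpr, hr] at this

lemma mvpStep_self (s : Fin n → Option (Fin n)) (c p : Fin n) : mvpStep s c p p = some c := by
  rcases mvpStep_eq s c p with h | ⟨j, k, _, ⟨hpk, _⟩, h⟩
  · simp [h]
  · simp [h, hpk.ne]

lemma mvpStep_ne_none {s : Fin n → Option (Fin n)} {q : Fin n} (c p : Fin n) (hq : s q ≠ none) :
    mvpStep s c p q ≠ none := by
  rcases mvpStep_eq s c p with h | ⟨j, k, _, _, h⟩ <;> rw [h] <;>
    simp only [Function.update_apply] <;> split_ifs <;> simp [hq]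

/-- A car found in spot `q` after a step has just arrived there, was there already, or has just
been bumped from `p` into the first empty spot `q` beyond `p`. -/
lemma mvpStep_eq_some {s : Fin n → Option (Fin n)} {c p q x : Fin n}
    (h : mvpStep s c p q = some x) :
    (q = p ∧ x = c) ∨ (q ≠ p ∧ s q = some x) ∨
      (p < q ∧ s p = some x ∧ s q = none ∧ ∀ r, p < r → r < q → s r ≠ none) := by
  by_cases hqp : q = p
  · subst hqp
    rw [mvpStep_self] at h
    exact .inl ⟨rfl, (Option.some.inj h).symm⟩
  refine .inr ?_
  rcases mvpStep_eq s c p with hs | ⟨j, k, hj, ⟨hpk, hk, hbetween⟩, hs⟩ <;> rw [hs] at h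
  · rw [Function.update_of_ne hqp] at h
    exact .inl ⟨hqp, h⟩
  · by_cases hqk : q = k
    · subst hqk
      rw [Function.update_self] at h
      exact .inr ⟨hpk, by rw [hj, h], hk, hbetween⟩
    · rw [Function.update_of_ne hqk, Function.update_of_ne hqp] at h
      exact .inl ⟨hqp, h⟩

/-- The state of the MVP parking process after the first `t` cars have entered. -/
def runTo (α : Fin n → Fin n) (t : ℕ) : Fin n → Option (Fin n) :=
  ((List.finRange n).take t).foldl (fun st c => mvpStep st c (α c)) (fun _ => none)

variable {α : Fin n → Fin n}

lemma runTo_self : runTo α n = mvpRun α := by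
  rw [runTo, List.take_of_length_le (by simp), mvpRun]

lemma runTo_succ (t : Fin n) : runTo α (t + 1) = mvpStep (runTo α t) t (α t) := by
  rw [runTo, List.take_add_one, List.foldl_append, runTo]
  simp

lemma runTo_ne_none_succ {t q : Fin n} (h : runTo α t q ≠ none) : runTo α (t + 1) q ≠ none := by
  rw [runTo_succ]
  exact mvpStep_ne_none _ _ h

lemma lt_of_runTo_eq_some {t : ℕ} (ht : t ≤ n) {q x : Fin n} (h : runTo α t q = some x) :
    x.1 < t := by
  induction t generalizing q with
  | zero => simp [runTo] at h
  | succ t ih =>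
    have hs := runTo_succ (α := α) ⟨t, ht⟩
    simp only at hs
    rw [hs] at h
    rcases mvpStep_eq_some h with ⟨_, rfl⟩ | ⟨_, h⟩ | ⟨_, h, _⟩
    · simp
    · exact (ih (by omega) h).trans (by simp)
    · exact (ih (by omega) h).trans (by simp)

lemma runTo_succ_eq_some {t q x : Fin n} (hx : x < t) (h : runTo α (t + 1) q = some x) :
    (q ≠ α t ∧ runTo α t q = some x) ∨
      (α t < q ∧ runTo α t (α t) = some x ∧ runTo α t q = none ∧
        ∀ r, α t < r → r < q → runTo α t r ≠ none) := by
  rw [runTo_succ] at h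
  rcases mvpStep_eq_some h with ⟨_, rfl⟩ | h | h
  · exact absurd hx (lt_irrefl _)
  · exact .inl h
  · exact .inr h

lemma eq_of_runTo_succ_self {x q : Fin n} (h : runTo α (x + 1) q = some x) : q = α x := by
  rw [runTo_succ] at h
  rcases mvpStep_eq_some h with ⟨h, _⟩ | ⟨_, h⟩ | ⟨_, h, _⟩
  · exact h
  · exact absurd (lt_of_runTo_eq_some x.2.le h) (lt_irrefl _)
  · exact absurd (lt_of_runTo_eq_some x.2.le h) (lt_irrefl _)

/-- Every spot between a car's preference and its current spot is occupied. -/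
lemma runTo_ne_none_of_le {t : ℕ} (ht : t ≤ n) {q x : Fin n} (hx : x.1 < t)
    (h : runTo α t q = some x) :
    α x ≤ q ∧ ∀ r, α x ≤ r → r ≤ q → runTo α t r ≠ none := by
  induction t, Nat.succ_le_iff.2 hx using Nat.le_induction generalizing q with
  | base =>
    obtain rfl := eq_of_runTo_succ_self h
    refine ⟨le_rfl, fun r h₁ h₂ => ?_⟩
    obtain rfl := le_antisymm h₁ h₂
    simp [h]
  | succ t hxt ih =>
    have hfinal : runTo α (t + 1) q ≠ none := by simp [h]
    rcases runTo_succ_eq_some (t := ⟨t, ht⟩) (Fin.lt_def.2 hxt) h with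
      ⟨_, h⟩ | ⟨hlt, h, _, hbetween⟩
    · obtain ⟨hle, hocc⟩ := ih (by omega) hxt h
      exact ⟨hle, fun r h₁ h₂ => runTo_ne_none_succ (t := ⟨t, ht⟩) (hocc r h₁ h₂)⟩
    · obtain ⟨hle, hocc⟩ := ih (by omega) hxt h
      refine ⟨hle.trans hlt.le, fun r h₁ h₂ => ?_⟩
      rcases h₂.lt_or_eq with h₂ | rfl
      · refine runTo_ne_none_succ (t := ⟨t, ht⟩) ?_
        rcases le_or_gt r (α ⟨t, ht⟩) with h₃ | h₃
        · exact hocc r h₁ h₃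
        · exact hbetween r h₃ h₂
      · exact hfinal

/-- A car that no later car can reach has already attained its spot. -/
lemma runTo_eq_some_of_later_lt {t T : ℕ} (htT : t ≤ T) (hT : T ≤ n) {q x : Fin n} (hx : x.1 < t)
    (hlater : ∀ d : Fin n, t ≤ d.1 → α d < α x) (h : runTo α T q = some x) :
    runTo α t q = some x := by
  induction T, htT using Nat.le_induction with
  | base => exact h
  | succ T htT ih =>
    rcases runTo_succ_eq_some (t := ⟨T, hT⟩) (Fin.lt_def.2 (hx.trans_le htT)) h with
      ⟨_, h⟩ | ⟨_, h, _⟩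
    · exact ih (by omega) h
    · exact absurd (runTo_ne_none_of_le (Nat.le_of_succ_le hT) (hx.trans_le htT) h).1
        (hlater ⟨T, hT⟩ htT).not_ge

/-- A car stays in its preferred spot until that spot is preferred again. -/
lemma eq_of_runTo_eq_some {t : ℕ} (ht : t ≤ n) {q x : Fin n} (hx : x.1 < t)
    (hne : ∀ d : Fin n, x < d → d.1 < t → α d ≠ α x) (h : runTo α t q = some x) : q = α x := by
  induction t, Nat.succ_le_iff.2 hx using Nat.le_induction generalizing q with
  | base => exact eq_of_runTo_succ_self h
  | succ t hxt ih =>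
    have hne' : ∀ d : Fin n, x < d → d.1 < t → α d ≠ α x :=
      fun d hd hdt => hne d hd (by omega)
    rcases runTo_succ_eq_some (t := ⟨t, ht⟩) (Fin.lt_def.2 hxt) h with ⟨_, h⟩ | ⟨_, h, _⟩
    · exact ih (by omega) hxt hne' h
    · exact absurd (ih (by omega) hxt hne' h) (hne ⟨t, ht⟩ (Fin.lt_def.2 hxt) (by simp))

lemma runTo_rev (h : ∀ j : Fin n, mvpRun α j = some j.rev) (x : Fin n) :
    runTo α n x.rev = some x := by
  rw [runTo_self, h, Fin.rev_rev]

lemma apply_le_rev (h : ∀ j : Fin n, mvpRun α j = some j.rev) (x : Fin n) : α x ≤ x.rev :=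
  (runTo_ne_none_of_le le_rfl x.2 (runTo_rev h x)).1

/-- If the outcome is decreasing, no spot is preferred by three cars. -/
lemma false_of_three_prefer (h : ∀ j : Fin n, mvpRun α j = some j.rev) {a b c : Fin n}
    (hab : a < b) (hbc : b < c) (hαab : α a = α b) (hαbc : α b = α c)
    (hlast : ∀ d, c < d → α d ≠ α c) (hnext : ∀ d, b < d → d < c → α d ≠ α b) : False := by
  have hc : c.rev = α c :=
    eq_of_runTo_eq_some le_rfl c.2 (fun d hd _ => hlast d hd) (runTo_rev h c)
  have hlater : ∀ d : Fin n, c.1 + 1 ≤ d.1 → α d < α c := fun d hd =>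
    (apply_le_rev h d).trans_lt (hc ▸ Fin.rev_lt_rev.2 (Fin.lt_def.2 hd))
  have ha : runTo α (c + 1) a.rev = some a :=
    runTo_eq_some_of_later_lt c.2 le_rfl (Nat.lt_succ_of_lt (hab.trans hbc))
      (by rwa [hαab, hαbc]) (runTo_rev h a)
  have hb : runTo α (c + 1) b.rev = some b :=
    runTo_eq_some_of_later_lt c.2 le_rfl (Nat.lt_succ_of_lt hbc) (by rwa [hαbc]) (runTo_rev h b)
  have hbpos : ∀ q, runTo α c q = some b → q = α c := fun q hq =>
    (eq_of_runTo_eq_some c.2.le hbc (fun d hd hdc => hnext d hd hdc) hq).trans hαbc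
  rcases runTo_succ_eq_some hbc hb with ⟨hne, hb⟩ | ⟨_, hb, hempty, _⟩
  · exact hne (hbpos _ hb)
  rcases runTo_succ_eq_some (hab.trans hbc) ha with ⟨_, ha⟩ | ⟨_, ha, _⟩
  · refine (runTo_ne_none_of_le c.2.le (hab.trans hbc) ha).2 b.rev ?_
      (Fin.rev_lt_rev.2 hab).le hempty
    rw [hαab]
    exact apply_le_rev h b
  · rw [hb] at ha
    exact hab.ne' (Option.some.inj ha)

lemma mcount_le_two (h : ∀ j : Fin n, mvpRun α j = some j.rev) (j : Fin n) : mcount α j ≤ 2 := by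
  by_contra! hcard
  unfold mcount at hcard
  set s := univ.filter (fun i => α i = j) with hs
  have hmem : ∀ {i}, i ∈ s ↔ α i = j := by simp [hs]
  have hs₀ : s.Nonempty := card_pos.1 (by omega)
  set c := s.max' hs₀ with hc
  have hcs : c ∈ s := s.max'_mem hs₀
  have hcard₁ : (s.erase c).card = s.card - 1 := card_erase_of_mem hcs
  have hs₁ : (s.erase c).Nonempty := card_pos.1 (by omega)
  set b := (s.erase c).max' hs₁ with hb
  have hbs : b ∈ s.erase c := (s.erase c).max'_mem hs₁
  have hcard₂ : ((s.erase c).erase b).card = (s.erase c).card - 1 := card_erase_of_mem hbs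
  obtain ⟨a, ha⟩ : ((s.erase c).erase b).Nonempty := card_pos.1 (by omega)
  have hαc := hmem.1 hcs
  have hαb := hmem.1 (mem_of_mem_erase hbs)
  have hαa := hmem.1 (mem_of_mem_erase (mem_of_mem_erase ha))
  refine false_of_three_prefer h (a := a) (b := b) (c := c)
    (lt_of_le_of_ne (le_max' _ _ (mem_of_mem_erase ha)) (ne_of_mem_erase ha))
    (lt_of_le_of_ne (le_max' _ _ (mem_of_mem_erase hbs)) (ne_of_mem_erase hbs))
    (hαa.trans hαb.symm) (hαb.trans hαc.symm) (fun d hd hαd => ?_) (fun d hd hdc hαd => ?_)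
  · exact (le_max' s d (hmem.2 (hαd.trans hαc))).not_gt hd
  · exact (le_max' (s.erase c) d
      (mem_erase.2 ⟨hdc.ne, hmem.2 (hαd.trans hαb)⟩)).not_gt hd

lemma stepSeq_eq (h : ∀ j : Fin n, mvpRun α j = some j.rev) (j : Fin n) :
    stepSeq α j = mcount α j - 1 := by
  have := mcount_le_two h j
  unfold stepSeq
  split_ifs <;> omega

lemma sum_mcount (s : Finset (Fin n)) :
    ∑ j ∈ s, mcount α j = (univ.filter (fun i => α i ∈ s)).card := by
  rw [card_eq_sum_card_fiberwise (f := α) (t := s) (fun i hi => by simpa using hi)]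
  refine sum_congr rfl fun j hj => congrArg card ?_
  ext i
  simp only [mem_filter, mem_univ, true_and]
  exact ⟨fun hi => ⟨hi ▸ hj, hi⟩, fun hi => hi.2⟩

lemma sum_stepSeq (h : ∀ j : Fin n, mvpRun α j = some j.rev) (s : Finset (Fin n)) :
    ∑ j ∈ s, stepSeq α j = (univ.filter (fun i => α i ∈ s)).card - (s.card : ℤ) := by
  rw [← sum_mcount, sum_congr rfl fun j _ => stepSeq_eq h j]
  simp

end MVPPark

open MVPPark in
/-- If the outcome of `α` is the decreasing permutation `w₀`, then the step sequence of
`α` is a Motzkin step sequence: all partial sums are nonnegative and the total sum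
is `0`. -/
theorem stepSeq_motzkin (n : ℕ) (hn : 1 ≤ n) (α : Fin n → Fin n)
    (h : ∀ j : Fin n, mvpRun α j = some j.rev) :
    (∀ i : ℕ, 1 ≤ i → i ≤ n →
        0 ≤ ∑ j ∈ Finset.univ.filter (fun j : Fin n => j.1 < i), stepSeq α j) ∧
      ∑ j : Fin n, stepSeq α j = 0 := by
  refine ⟨fun i _ _ => ?_, by simp [sum_stepSeq h]⟩
  rw [sum_stepSeq h, sub_nonneg, Nat.cast_le]
  refine card_le_card_of_injOn Fin.rev (fun j hj => ?_) Fin.rev_injective.injOn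
  simp only [coe_filter, mem_filter, mem_univ, true_and, Set.mem_ofPred_eq] at hj ⊢
  have := Fin.le_def.1 (apply_le_rev h j.rev)
  rw [Fin.rev_rev] at this
  omega
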